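/- For words u, v ∈ E⁺ the following are equivalent: (1) ū = v̄ in IG(E); (2) there exist minimal r-factorisations u = p₁⋯pₘ and v = q₁⋯qₘ with the same number of factors such that (p₁,…,pₘ) ∼ (q₁,…,qₘ); (3) there exists m ≥ 1 such that every minimal r-factorisation of u and every minimal r-factorisation of v has exactly m factors, and whenever u = p₁⋯pₘ and v = q₁⋯qₘ are such factorisations we have (p₁,…,pₘ) ∼ (q₁,…,qₘ). -/

import Mathlib

section Green

variable {T : Type*} [Semigroup T]

/-- Green's relation 𝓡. -/
def GreenR (a b : T) : Prop := a = b ∨ ∃ x y : T, a * x = b ∧ b * y = a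

/-- Green's relation 𝓛. -/
def GreenL (a b : T) : Prop := a = b ∨ ∃ x y : T, x * a = b ∧ y * b = a

/-- Green's relation 𝓓 = 𝓡 ∘ 𝓛. -/
def GreenD (a b : T) : Prop := ∃ c : T, GreenR a c ∧ GreenL c b

/-- An element is regular if `a = a * b * a` for some `b`. -/
def IsRegularElem (a : T) : Prop := ∃ b : T, a * b * a = a

/-- The principal two-sided ideal `T¹ a T¹`. -/
def principalIdeal (a : T) : Set T :=
  {x | x = a ∨ (∃ u, u * a = x) ∨ (∃ v, a * v = x) ∨ ∃ u v, u * a * v = x}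

/-- Green's relation 𝓙. -/
def GreenJ (a b : T) : Prop := principalIdeal a = principalIdeal b

/-- The 𝓙-preorder. -/
def JleRel (a b : T) : Prop := principalIdeal a ⊆ principalIdeal b

/-- Strict 𝓙-order. -/
def JltRel (a b : T) : Prop := JleRel a b ∧ ¬ JleRel b a

/-- `u` is a (two-sided) identity element. -/
def IsIdentityElem (u : T) : Prop := ∀ x : T, u * x = x ∧ x * u = x

/-- The relation 𝓡̃. -/
def RTilde (a b : T) : Prop := ∀ ε : T, ε * ε = ε → (ε * a = a ↔ ε * b = b)

/-- The relation 𝓛̃. -/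
def LTilde (a b : T) : Prop := ∀ ε : T, ε * ε = ε → (a * ε = a ↔ b * ε = b)

/-- `blockProd p i k = p i * p (i+1) * ⋯ * p (i+k)`. -/
def blockProd (p : ℕ → T) (i : ℕ) : ℕ → T
  | 0 => p i
  | k + 1 => blockProd p i k * p (i + (k + 1))

/-- Multiply `x` by optional (possibly empty) words on both sides. -/
def withCtx (u : Option T) (x : T) (v : Option T) : T :=
  match u, v with
  | none, none => x
  | some u', none => u' * x
  | none, some v' => x * v'
  | some u', some v' => u' * x * v'

/-- Multiply by an optional word on the left. -/
def leftCtx (u : Option T) (x : T) : T := match u with | none => x | some u' => u' * x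

/-- Multiply by an optional word on the right. -/
def rightCtx (x : T) (v : Option T) : T := match v with | none => x | some v' => x * v'

end Green

section IGdef

/-- The set of idempotents of `S`. -/
abbrev IdemE (S : Type*) [Semigroup S] : Type _ := {x : S // x * x = x}

variable {S : Type*} [Semigroup S]

/-- `e, f` form a basic pair if `{e,f} ∩ {ef,fe} ≠ ∅`. -/
def BasicPair (e f : IdemE S) : Prop :=
  (e : S) * f = e ∨ (e : S) * f = f ∨ (f : S) * e = e ∨ (f : S) * e = f

/-- The defining relations of IG(E): `ef = g` whenever `e, f` is a basic pair with
product `g` in `S`. -/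
def igRelBase (u v : FreeSemigroup (IdemE S)) : Prop :=
  ∃ e f g : IdemE S, BasicPair e f ∧ (g : S) = (e : S) * (f : S) ∧
    u = FreeSemigroup.of e * FreeSemigroup.of f ∧ v = FreeSemigroup.of g

/-- The congruence on the free semigroup `E⁺` generated by the defining relations. -/
def igCon (S : Type*) [Semigroup S] : Con (FreeSemigroup (IdemE S)) :=
  conGen (fun u v => igRelBase u v)

/-- The free idempotent generated semigroup IG(E). -/
abbrev IG (S : Type*) [Semigroup S] := (igCon S).Quotient

/-- `w̄`, the image of a word `w ∈ E⁺` in IG(E). -/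
def igBar (w : FreeSemigroup (IdemE S)) : IG S := (w : (igCon S).Quotient)

/-- The list of letters of a word. -/
def wordList (w : FreeSemigroup (IdemE S)) : List (IdemE S) := w.head :: w.tail

/-- The length of a word. -/
def wlen (w : FreeSemigroup (IdemE S)) : ℕ := (wordList w).length

/-- Length of an optional word. -/
def olen (u : Option (FreeSemigroup (IdemE S))) : ℕ :=
  match u with | none => 0 | some u' => wlen u'

/-- `p 1, …, p m` is an r-factorisation of `w`: each factor represents a regular
element of IG(E). -/
def IsRFact (w : FreeSemigroup (IdemE S)) (m : ℕ) (p : ℕ → FreeSemigroup (IdemE S)) : Prop :=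
  1 ≤ m ∧ blockProd p 1 (m - 1) = w ∧ ∀ i, 1 ≤ i → i ≤ m → IsRegularElem (igBar (p i))

/-- A minimal r-factorisation: no product of two or more consecutive factors is regular. -/
def IsMinRFact (w : FreeSemigroup (IdemE S)) (m : ℕ) (p : ℕ → FreeSemigroup (IdemE S)) : Prop :=
  IsRFact w m p ∧
    ∀ i j, 1 ≤ i → i < j → j ≤ m → ¬ IsRegularElem (igBar (blockProd p i (j - i)))

/-- The relation ≈ on m-tuples of words. -/
def TupleApprox (m : ℕ) (p q : ℕ → FreeSemigroup (IdemE S)) : Prop :=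
  (∃ i, 1 ≤ i ∧ i ≤ m ∧ igBar (p i) = igBar (q i) ∧
    ∀ j, 1 ≤ j → j ≤ m → j ≠ i → p j = q j) ∨
  (∃ i, ∃ e : IdemE S, 1 ≤ i ∧ i < m ∧
    igBar (p i) = igBar (q i * FreeSemigroup.of e) ∧
    igBar (q (i + 1)) = igBar (FreeSemigroup.of e * p (i + 1)) ∧
    ∀ j, 1 ≤ j → j ≤ m → j ≠ i → j ≠ i + 1 → p j = q j) ∨
  (∃ i, ∃ e : IdemE S, 1 ≤ i ∧ i < m ∧
    igBar (q i) = igBar (p i * FreeSemigroup.of e) ∧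
    igBar (p (i + 1)) = igBar (FreeSemigroup.of e * q (i + 1)) ∧
    ∀ j, 1 ≤ j → j ≤ m → j ≠ i → j ≠ i + 1 → p j = q j)

/-- The relation ∼: the transitive closure of ≈. -/
def TupleSim (m : ℕ) (p q : ℕ → FreeSemigroup (IdemE S)) : Prop :=
  Relation.TransGen (TupleApprox m) p q

/-- One application of a defining relation of IG(E) inside a word. -/
def RewriteStep (w w' : FreeSemigroup (IdemE S)) : Prop :=
  ∃ (u v : Option (FreeSemigroup (IdemE S))) (x y : FreeSemigroup (IdemE S)),
    (igRelBase x y ∨ igRelBase y x) ∧ w = withCtx u x v ∧ w' = withCtx u y v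

/-- `e` is a seed of `w` at (1-based) position `k`. -/
def SeedAt (w : FreeSemigroup (IdemE S)) (e : IdemE S) (k : ℕ) : Prop :=
  ∃ u v : Option (FreeSemigroup (IdemE S)),
    w = withCtx u (FreeSemigroup.of e) v ∧ k = olen u + 1 ∧
    GreenL (igBar (leftCtx u (FreeSemigroup.of e))) (igBar (FreeSemigroup.of e)) ∧
    GreenR (igBar (FreeSemigroup.of e)) (igBar (rightCtx (FreeSemigroup.of e) v))

/-- The coordinate (position within `w` of the first letter) of the `i`-th factor. -/
def wcoord (p : ℕ → FreeSemigroup (IdemE S)) (i : ℕ) : ℕ :=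
  1 + ∑ j ∈ Finset.Ico 1 i, wlen (p j)

end IGdef

section WordEval

variable {S : Type*} [Semigroup S]

/-- The value of a letter in IG(E) with an identity adjoined. -/
def letterVal (e : IdemE S) : WithOne (IG S) := (igBar (FreeSemigroup.of e) : IG S)

/-- The value of a possibly empty word in IG(E) with an identity adjoined. -/
def wordVal (l : List (IdemE S)) : WithOne (IG S) := (l.map letterVal).prod

@[simp] theorem wordVal_nil : wordVal ([] : List (IdemE S)) = 1 := rfl

@[simp] theorem wordVal_cons (e : IdemE S) (l : List (IdemE S)) :
    wordVal (e :: l) = letterVal e * wordVal l := by simp [wordVal]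

@[simp] theorem wordVal_append (l l' : List (IdemE S)) :
    wordVal (l ++ l') = wordVal l * wordVal l' := by simp [wordVal]

theorem wordList_ne_nil (w : FreeSemigroup (IdemE S)) : wordList w ≠ [] := by simp [wordList]

theorem wordList_injective : Function.Injective (wordList (S := S)) := by
  rintro ⟨a, l⟩ ⟨b, l'⟩ h
  simpa [wordList] using h

theorem wordList_of (e : IdemE S) : wordList (FreeSemigroup.of e) = [e] := rfl

theorem wordList_mul (u v : FreeSemigroup (IdemE S)) :
    wordList (u * v) = wordList u ++ wordList v := by
  simp [wordList, FreeSemigroup.tail_mul, FreeSemigroup.head_mul]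

theorem igBar_mul (u v : FreeSemigroup (IdemE S)) : igBar (u * v) = igBar u * igBar v := rfl

theorem wordVal_wordList (w : FreeSemigroup (IdemE S)) :
    wordVal (wordList w) = ((igBar w : IG S) : WithOne (IG S)) := by
  induction w using FreeSemigroup.recOnMul with
  | ih1 e => simp [wordList_of, letterVal]
  | ih2 e w _ ih =>
    rw [wordList_mul, wordVal_append, ih, igBar_mul, WithOne.coe_mul]
    simp [wordList_of, letterVal]

/-- A nonempty list of letters read as a word; the empty list is sent to `d`. -/
def wordOfList (d : FreeSemigroup (IdemE S)) : List (IdemE S) → FreeSemigroup (IdemE S)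
  | [] => d
  | a :: l => ⟨a, l⟩

theorem wordList_wordOfList (d : FreeSemigroup (IdemE S)) {l : List (IdemE S)} (h : l ≠ []) :
    wordList (wordOfList d l) = l := by
  cases l with
  | nil => exact absurd rfl h
  | cons a l => rfl

theorem wordOfList_wordList (d w : FreeSemigroup (IdemE S)) :
    wordOfList d (wordList w) = w := rfl

theorem exists_wordVal (a : WithOne (IG S)) : ∃ l : List (IdemE S), wordVal l = a := by
  refine WithOne.cases_on a ⟨[], rfl⟩ fun b => ?_
  exact Con.induction_on b fun w => ⟨wordList w, wordVal_wordList w⟩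

theorem wordVal_eq_one {l : List (IdemE S)} (h : wordVal l = 1) : l = [] := by
  cases l with
  | nil => rfl
  | cons a l =>
    have := wordVal_wordList (⟨a, l⟩ : FreeSemigroup (IdemE S))
    exact absurd (this.symm.trans h) WithOne.coe_ne_one

theorem letterVal_mul {e f g : IdemE S} (h : BasicPair e f) (hg : (g : S) = (e : S) * f) :
    letterVal e * letterVal f = letterVal g := by
  have : igBar (FreeSemigroup.of e * FreeSemigroup.of f) = igBar (FreeSemigroup.of g) :=
    (Con.eq _).2 (ConGen.Rel.of _ _ ⟨e, f, g, h, hg, rfl, rfl⟩)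
  rw [letterVal, letterVal, letterVal, ← this, igBar_mul, WithOne.coe_mul]

@[simp] theorem letterVal_mul_self (e : IdemE S) : letterVal e * letterVal e = letterVal e :=
  letterVal_mul (Or.inl e.2) e.2.symm

/-- A basic pair `e, f` is contracted to its product inside a word. -/
def Contracts (w w' : List (IdemE S)) : Prop :=
  ∃ (u v : List (IdemE S)) (e f g : IdemE S), BasicPair e f ∧ (g : S) = (e : S) * f ∧
    w = u ++ e :: f :: v ∧ w' = u ++ g :: v

theorem Contracts.append {w w' : List (IdemE S)} (a b : List (IdemE S)) (h : Contracts w w') :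
    Contracts (a ++ w ++ b) (a ++ w' ++ b) := by
  obtain ⟨u, v, e, f, g, hb, hg, rfl, rfl⟩ := h
  exact ⟨a ++ u, v ++ b, e, f, g, hb, hg, by simp, by simp⟩

theorem eqvGen_contracts_append {w w' : List (IdemE S)} (a b : List (IdemE S))
    (h : Relation.EqvGen Contracts w w') :
    Relation.EqvGen Contracts (a ++ w ++ b) (a ++ w' ++ b) := by
  induction h with
  | rel x y h => exact .rel _ _ (h.append a b)
  | refl x => exact .refl _
  | symm x y _ ih => exact .symm _ _ ih
  | trans x y z _ _ ih₁ ih₂ => exact .trans _ _ _ ih₁ ih₂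

theorem eqvGen_contracts_of_wordVal_eq {w w' : List (IdemE S)} (h : wordVal w = wordVal w') :
    Relation.EqvGen Contracts w w' := by
  have key : ∀ u v : FreeSemigroup (IdemE S),
      ConGen.Rel (fun u v => igRelBase (S := S) u v) u v →
      Relation.EqvGen Contracts (wordList u) (wordList v) := by
    intro u v h
    induction h with
    | of x y h =>
      obtain ⟨e, f, g, hb, hg, rfl, rfl⟩ := h
      exact .rel _ _ ⟨[], [], e, f, g, hb, hg, rfl, rfl⟩
    | refl x => exact .refl _
    | symm _ ih => exact .symm _ _ ih
    | trans _ _ ih₁ ih₂ => exact .trans _ _ _ ih₁ ih₂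
    | @mul a b c d _ _ ih₁ ih₂ =>
      rw [wordList_mul, wordList_mul]
      refine .trans _ (wordList b ++ wordList c) _ ?_ ?_
      · simpa using eqvGen_contracts_append [] (wordList c) ih₁
      · simpa using eqvGen_contracts_append (wordList b) [] ih₂
  cases w with
  | nil => rw [wordVal_eq_one h.symm]; exact .refl _
  | cons a l =>
    cases w' with
    | nil => exact absurd (wordVal_eq_one h) (by simp)
    | cons b l' =>
      have h₁ := wordVal_wordList (⟨a, l⟩ : FreeSemigroup (IdemE S))
      have h₂ := wordVal_wordList (⟨b, l'⟩ : FreeSemigroup (IdemE S))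
      exact key ⟨a, l⟩ ⟨b, l'⟩ ((Con.eq _).1 (WithOne.coe_inj.1 (h₁.symm.trans (h.trans h₂))))

/-- The word `w` contains a letter `e` such that `w = u e v` with `u e 𝓛 e 𝓡 e v` in IG(E). -/
def Seeded (w : List (IdemE S)) : Prop :=
  ∃ (u : List (IdemE S)) (e : IdemE S) (v : List (IdemE S)), w = u ++ e :: v ∧
    (∃ t, t * wordVal u * letterVal e = letterVal e) ∧
    ∃ s, letterVal e * wordVal v * s = letterVal e

theorem Seeded.of_contracts {w w' : List (IdemE S)} (h : Contracts w w') (hw : Seeded w) :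
    Seeded w' := by
  obtain ⟨u₁, u₂, e, f, g, hb, hg, rfl, rfl⟩ := h
  obtain ⟨u, s, v, hw, ⟨t, ht⟩, r, hr⟩ := hw
  have hefg := letterVal_mul hb hg
  obtain ⟨a, rfl, ha⟩ | ⟨a, rfl, ha⟩ := List.append_eq_append_iff.1 hw <;> clear hw
  · match a, ha with
    | [], ha =>
      obtain ⟨rfl, rfl⟩ : e = s ∧ f :: u₂ = v := by simpa using ha
      clear ha
      refine ⟨u₁, g, u₂, rfl, ⟨t, ?_⟩, r * letterVal f, ?_⟩
      · rw [← hefg, ← mul_assoc, ← u₁.append_nil, ht]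
      · grind only [wordVal_append, wordVal_cons, wordVal_nil]
    | [x], ha =>
      obtain ⟨rfl, rfl, rfl⟩ : e = x ∧ f = s ∧ u₂ = v := by simpa using ha
      clear ha
      refine ⟨u₁, g, u₂, rfl, ⟨letterVal e * t, ?_⟩, r, ?_⟩
      · simp only [wordVal_append, wordVal_cons, wordVal_nil, mul_one, mul_assoc] at ht
        simp only [← hefg, mul_assoc, ht]
      · rw [← hefg, mul_assoc, mul_assoc, ← mul_assoc (letterVal f), hr]
    | x :: y :: a, ha =>
      obtain ⟨rfl, rfl, rfl⟩ : e = x ∧ f = y ∧ u₂ = a ++ s :: v := by simpa using ha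
      clear ha
      refine ⟨u₁ ++ g :: a, s, v, by simp, ⟨t, ?_⟩, r, ?_⟩ <;>
        grind only [wordVal_append, wordVal_cons, wordVal_nil]
  · match a, ha with
    | [], ha =>
      obtain ⟨rfl, rfl⟩ : e = s ∧ f :: u₂ = v := by simpa [eq_comm] using ha
      clear ha
      refine ⟨u, g, u₂, by simp, ⟨t, ?_⟩, r * letterVal f, ?_⟩
      · rw [← hefg, ← mul_assoc, ht]
      · grind only [wordVal_append, wordVal_cons, wordVal_nil]
    | x :: a, ha =>
      obtain ⟨rfl, rfl⟩ : s = x ∧ v = a ++ e :: f :: u₂ := by simpa using ha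
      clear ha
      refine ⟨u, s, a ++ g :: u₂, by simp, ⟨t, ?_⟩, r, ?_⟩ <;>
        grind only [wordVal_append, wordVal_cons, wordVal_nil]

theorem Seeded.of_contracts_symm {w w' : List (IdemE S)} (h : Contracts w w') (hw : Seeded w') :
    Seeded w := by
  obtain ⟨u₁, u₂, e, f, g, hb, hg, rfl, rfl⟩ := h
  obtain ⟨u, s, v, hw, ⟨t, ht⟩, r, hr⟩ := hw
  have hefg := letterVal_mul hb hg
  have expand : (∃ t, t * wordVal u₁ * letterVal g = letterVal g) →
      (∃ r, letterVal g * wordVal u₂ * r = letterVal g) → Seeded (u₁ ++ e :: f :: u₂) := by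
    rintro ⟨t, ht⟩ ⟨r, hr⟩
    have he := letterVal_mul_self e
    have hf := letterVal_mul_self f
    rcases hb with h | h | h | h
    · obtain rfl : g = e := Subtype.ext (hg.trans h)
      refine ⟨u₁, g, f :: u₂, rfl, ⟨t, ?_⟩, r, ?_⟩ <;>
        grind only [wordVal_append, wordVal_cons, wordVal_nil]
    · obtain rfl : g = f := Subtype.ext (hg.trans h)
      refine ⟨u₁ ++ [e], g, u₂, by simp, ⟨t, ?_⟩, r, ?_⟩ <;>
        grind only [wordVal_append, wordVal_cons, wordVal_nil]
    · have hge : letterVal g * letterVal e = letterVal e := by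
        have : (g : S) * e = e := by rw [hg, mul_assoc, h, e.2]
        exact letterVal_mul (Or.inr (Or.inl this)) this.symm
      refine ⟨u₁, e, f :: u₂, rfl, ⟨t, ?_⟩, r * letterVal e, ?_⟩
      · rw [← hge, ← mul_assoc, ht]
      · grind only [wordVal_append, wordVal_cons, wordVal_nil]
    · have hfg : letterVal f * letterVal g = letterVal f := by
        have : (f : S) * g = f := by rw [hg, ← mul_assoc, h, f.2]
        exact letterVal_mul (Or.inl this) this.symm
      refine ⟨u₁ ++ [e], f, u₂, by simp, ⟨letterVal f * t, ?_⟩, r, ?_⟩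
      · rw [mul_assoc] at ht
        simp only [wordVal_append, wordVal_cons, wordVal_nil, mul_one, mul_assoc, hefg, ht, hfg]
      · grind only [wordVal_append, wordVal_cons, wordVal_nil]
  obtain ⟨a, rfl, ha⟩ | ⟨a, rfl, ha⟩ := List.append_eq_append_iff.1 hw <;> clear hw
  · match a, ha with
    | [], ha =>
      obtain ⟨rfl, rfl⟩ : g = s ∧ u₂ = v := by simpa using ha
      exact expand ⟨t, by simpa using ht⟩ ⟨r, hr⟩
    | x :: a, ha =>
      obtain ⟨rfl, rfl⟩ : g = x ∧ u₂ = a ++ s :: v := by simpa using ha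
      clear ha
      refine ⟨u₁ ++ e :: f :: a, s, v, by simp, ⟨t, ?_⟩, r, ?_⟩ <;>
        grind only [wordVal_append, wordVal_cons, wordVal_nil]
  · match a, ha with
    | [], ha =>
      obtain ⟨rfl, rfl⟩ : s = g ∧ v = u₂ := by simpa using ha
      exact expand ⟨t, by simpa using ht⟩ ⟨r, hr⟩
    | x :: a, ha =>
      obtain ⟨rfl, rfl⟩ : s = x ∧ v = a ++ g :: u₂ := by simpa using ha
      clear ha
      refine ⟨u, s, a ++ e :: f :: u₂, by simp, ⟨t, ?_⟩, r, ?_⟩ <;>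
        grind only [wordVal_append, wordVal_cons, wordVal_nil]

theorem seeded_congr {w w' : List (IdemE S)} (h : wordVal w = wordVal w') :
    Seeded w ↔ Seeded w' := by
  have h' := eqvGen_contracts_of_wordVal_eq h
  clear h
  induction h' with
  | rel x y h => exact ⟨.of_contracts h, .of_contracts_symm h⟩
  | refl x => exact Iff.rfl
  | symm x y _ ih => exact ih.symm
  | trans x y z _ _ ih₁ ih₂ => exact ih₁.trans ih₂

end WordEval

section Seeds

variable {S : Type*} [Semigroup S]

/-- An element of IG(E) represented by a seeded word. -/
def HasSeed (a : WithOne (IG S)) : Prop := ∃ w, wordVal w = a ∧ Seeded w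

theorem hasSeed_wordVal {w : List (IdemE S)} : HasSeed (wordVal w) ↔ Seeded w :=
  ⟨fun ⟨_, h, hs⟩ => (seeded_congr h).1 hs, fun h => ⟨w, rfl, h⟩⟩

theorem not_hasSeed_one : ¬ HasSeed (1 : WithOne (IG S)) := by
  rintro ⟨w, h, u, e, v, rfl, -⟩
  simpa using wordVal_eq_one h

theorem hasSeed_letterVal (e : IdemE S) : HasSeed (letterVal e) :=
  ⟨[e], by simp, [], e, [], rfl, ⟨1, by simp⟩, 1, by simp⟩

theorem HasSeed.ne_nil {w : List (IdemE S)} (h : HasSeed (wordVal w)) : w ≠ [] := by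
  rintro rfl
  exact not_hasSeed_one h

theorem HasSeed.mul_right {a x y : WithOne (IG S)} (ha : HasSeed a) (h : a * x * y = a) :
    HasSeed (a * x) := by
  obtain ⟨w, rfl, u, e, v, rfl, ⟨t, ht⟩, s, hs⟩ := ha
  obtain ⟨x, rfl⟩ := exists_wordVal x
  refine ⟨u ++ e :: (v ++ x), by simp [mul_assoc], u, e, v ++ x, rfl, ⟨t, ht⟩, y * s, ?_⟩
  have h' := congrArg (fun z => t * z * s) h
  simp only [wordVal_append, wordVal_cons, ← mul_assoc, ht] at h'
  simpa only [wordVal_append, ← mul_assoc, hs] using h'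

theorem HasSeed.mul_left {a x y : WithOne (IG S)} (ha : HasSeed a) (h : y * (x * a) = a) :
    HasSeed (x * a) := by
  obtain ⟨w, rfl, u, e, v, rfl, ⟨t, ht⟩, s, hs⟩ := ha
  obtain ⟨x, rfl⟩ := exists_wordVal x
  refine ⟨x ++ u ++ e :: v, by simp, x ++ u, e, v, rfl, ⟨t * y, ?_⟩, s, hs⟩
  have h' := congrArg (fun z => t * z * s) h
  rw [mul_assoc] at hs
  simp only [wordVal_append, wordVal_cons, mul_assoc, hs] at h'
  rw [mul_assoc] at ht
  simpa only [wordVal_append, mul_assoc, ht] using h'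

theorem HasSeed.split {a b : WithOne (IG S)} (h : HasSeed (a * b)) :
    (HasSeed a ∧ ∃ y, a * b * y = a) ∨ (HasSeed b ∧ ∃ y, y * (a * b) = b) := by
  suffices (∃ y, a * b * y = a) ∨ ∃ y, y * (a * b) = b by
    rcases this with ⟨y, hy⟩ | ⟨y, hy⟩
    · exact .inl ⟨by simpa only [hy] using h.mul_right (x := y) (y := b) (by rw [hy]), y, hy⟩
    · exact .inr ⟨by simpa only [hy] using h.mul_left (x := y) (y := a) (by rw [hy]), y, hy⟩
  obtain ⟨a, rfl⟩ := exists_wordVal a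
  obtain ⟨b, rfl⟩ := exists_wordVal b
  rw [← wordVal_append, hasSeed_wordVal] at h
  obtain ⟨u, e, v, h, ⟨t, ht⟩, s, hs⟩ := h
  have left : ∀ c, a = u ++ e :: c → v = c ++ b →
      ∃ y, wordVal a * wordVal b * y = wordVal a := by
    rintro c rfl rfl
    refine ⟨s * wordVal c, ?_⟩
    rw [wordVal_append, ← mul_assoc] at hs
    simp only [wordVal_append, wordVal_cons]
    rw [show wordVal u * (letterVal e * wordVal c) * wordVal b * (s * wordVal c) =
      wordVal u * ((letterVal e * wordVal c * wordVal b * s) * wordVal c) by simp only [mul_assoc],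
      hs]
  obtain ⟨c, rfl, hc⟩ | ⟨c, rfl, hc⟩ := List.append_eq_append_iff.1 h
  · right
    refine ⟨wordVal c * t, ?_⟩
    subst hc
    rw [wordVal_append] at ht
    simp only [wordVal_append, wordVal_cons]
    rw [show wordVal c * t * (wordVal a * (wordVal c * (letterVal e * wordVal v))) =
      wordVal c * (t * (wordVal a * wordVal c) * letterVal e * wordVal v) by
        simp only [mul_assoc], ht]
  · match c, hc with
    | [], hc =>
      right
      obtain rfl : e :: v = b := by simpa using hc
      refine ⟨t, ?_⟩
      simp only [wordVal_append, wordVal_cons, wordVal_nil, mul_one]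
      rw [← mul_assoc, ← mul_assoc, ht]
    | x :: c, hc =>
      obtain ⟨rfl, rfl⟩ : e = x ∧ v = c ++ b := by simpa using hc
      exact .inl (left c rfl rfl)

end Seeds

section Factorisations

variable {S : Type*} [Semigroup S]

/-- The values of the factors of a minimal factorisation into seeded words. -/
def SeedChain (V : List (WithOne (IG S))) : Prop :=
  (∀ a ∈ V, HasSeed a) ∧ V.IsChain fun a b => ¬ HasSeed (a * b)

theorem seedChain_nil : SeedChain ([] : List (WithOne (IG S))) := by simp [SeedChain]

theorem seedChain_singleton {a : WithOne (IG S)} : SeedChain [a] ↔ HasSeed a := by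
  simp [SeedChain]

theorem seedChain_cons_cons {a b : WithOne (IG S)} {V : List (WithOne (IG S))} :
    SeedChain (a :: b :: V) ↔ HasSeed a ∧ ¬ HasSeed (a * b) ∧ SeedChain (b :: V) := by
  simp only [SeedChain, List.forall_mem_cons, List.isChain_cons_cons]
  tauto

theorem SeedChain.head {a : WithOne (IG S)} {V : List (WithOne (IG S))} (h : SeedChain (a :: V)) :
    HasSeed a := h.1 a (by simp)

theorem SeedChain.tail {a : WithOne (IG S)} {V : List (WithOne (IG S))} (h : SeedChain (a :: V)) :
    SeedChain V := ⟨fun b hb => h.1 b (by simp [hb]), h.2.tail⟩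

theorem SeedChain.append_right {V W : List (WithOne (IG S))} (h : SeedChain (V ++ W)) :
    SeedChain W := by
  induction V with
  | nil => exact h
  | cons a V ih => exact ih h.tail

theorem SeedChain.head_congr {p q : WithOne (IG S)} {V : List (WithOne (IG S))}
    (h : SeedChain (p :: V)) (hq : HasSeed q) {c d : WithOne (IG S)} (hc : c * q = p)
    (hd : d * p = q) : SeedChain (q :: V) := by
  cases V with
  | nil => exact seedChain_singleton.2 hq
  | cons a V =>
    rw [seedChain_cons_cons] at h ⊢
    refine ⟨hq, fun hs => h.2.1 ?_, h.2.2⟩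
    rw [← hc, mul_assoc]
    exact hs.mul_left (y := d) (by rw [← mul_assoc c, hc, ← mul_assoc, hd])

theorem SeedChain.append_congr {p q : WithOne (IG S)} {A V W : List (WithOne (IG S))}
    (h : SeedChain (A ++ p :: V)) (hW : SeedChain (q :: W)) {c d : WithOne (IG S)}
    (hc : q * c = p) (hd : p * d = q) : SeedChain (A ++ q :: W) := by
  induction A with
  | nil => exact hW
  | cons a A ih =>
    cases A with
    | nil =>
      simp only [List.nil_append, List.cons_append, seedChain_cons_cons] at h ih ⊢
      refine ⟨h.1, fun hs => h.2.1 ?_, hW⟩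
      rw [← hc, ← mul_assoc]
      exact hs.mul_right (y := d) (by rw [mul_assoc a, hc, mul_assoc, hd])
    | cons b A =>
      simp only [List.cons_append, seedChain_cons_cons] at h ih ⊢
      exact ⟨h.1, h.2.1, ih h.2.2⟩

theorem SeedChain.shift {p q p' q' : WithOne (IG S)} {A V : List (WithOne (IG S))}
    (h : SeedChain (A ++ p :: q :: V)) {a b c d : WithOne (IG S)}
    (hp : p' * b = p) (hp' : p * a = p') (hq : c * q' = q) (hq' : d * q = q')
    (hpq : p * q = p' * q') : SeedChain (A ++ p' :: q' :: V) := by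
  obtain ⟨h₁, h₂, h₃⟩ := seedChain_cons_cons.1 h.append_right
  have hs : HasSeed p' := hp' ▸ h₁.mul_right (y := b) (by rw [hp', hp])
  have hs' : HasSeed q' := hq' ▸ h₃.head.mul_left (y := c) (by rw [hq', hq])
  exact h.append_congr (seedChain_cons_cons.2 ⟨hs, hpq ▸ h₂, h₃.head_congr hs' hq hq'⟩) hp hp'

theorem SeedChain.not_hasSeed_prod {p : WithOne (IG S)} {V : List (WithOne (IG S))}
    (h : SeedChain (p :: V)) (hV : V ≠ []) : ¬ HasSeed (p * V.prod) := by
  induction V generalizing p with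
  | nil => exact absurd rfl hV
  | cons k V ih =>
    obtain ⟨h₁, h₂, h₃⟩ := seedChain_cons_cons.1 h
    by_cases hV' : V = []
    · simpa [hV'] using h₂
    · intro hs
      rw [List.prod_cons] at hs
      rcases hs.split with ⟨-, y, hy⟩ | ⟨hs, -⟩
      · exact h₂ (h₁.mul_right (y := V.prod * y) (by simpa only [mul_assoc] using hy))
      · exact ih h₃ hV' hs

/-- The values of the factors of a factorised word. -/
abbrev factVals (L : List (List (IdemE S))) : List (WithOne (IG S)) := L.map wordVal

theorem prod_factVals (L : List (List (IdemE S))) : (factVals L).prod = wordVal L.flatten := by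
  induction L with
  | nil => rfl
  | cons a L ih => simpa using congrArg _ ih

theorem SeedChain.ne_nil {L : List (List (IdemE S))} (h : SeedChain (factVals L)) {x}
    (hx : x ∈ L) : x ≠ [] := HasSeed.ne_nil (h.1 _ (List.mem_map_of_mem hx))

/-- An elementary transformation of a factorised word. -/
inductive FactStep : List (List (IdemE S)) → List (List (IdemE S)) → Prop
  | congr (A C : List (List (IdemE S))) {x y : List (IdemE S)} (hx : x ≠ []) (hy : y ≠ [])
      (h : wordVal x = wordVal y) : FactStep (A ++ x :: C) (A ++ y :: C)
  | shift (A C : List (List (IdemE S))) {x y : List (IdemE S)} (f : IdemE S) (hx : x ≠ [])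
      (hy : y ≠ []) : FactStep (A ++ (x ++ [f]) :: y :: C) (A ++ x :: (f :: y) :: C)

/-- The equivalence relation generated by the elementary transformations. -/
abbrev FactSim : List (List (IdemE S)) → List (List (IdemE S)) → Prop := Relation.EqvGen FactStep

theorem FactStep.cons {L L' : List (List (IdemE S))} (x : List (IdemE S)) (h : FactStep L L') :
    FactStep (x :: L) (x :: L') := by
  cases h with
  | congr A C hx hy h => exact .congr (x :: A) C hx hy h
  | shift A C f hx hy => exact .shift (x :: A) C f hx hy

theorem factSim_cons {L L' : List (List (IdemE S))} (x : List (IdemE S)) (h : FactSim L L') :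
    FactSim (x :: L) (x :: L') := by
  induction h with
  | rel _ _ h => exact .rel _ _ (h.cons x)
  | refl _ => exact .refl _
  | symm _ _ _ ih => exact .symm _ _ ih
  | trans _ _ _ _ _ ih₁ ih₂ => exact .trans _ _ _ ih₁ ih₂

theorem FactSim.length_eq {L L' : List (List (IdemE S))} (h : FactSim L L') :
    L.length = L'.length := by
  induction h with
  | rel _ _ h => cases h <;> simp
  | refl _ => rfl
  | symm _ _ _ ih => exact ih.symm
  | trans _ _ _ _ _ ih₁ ih₂ => exact ih₁.trans ih₂

theorem factSim_shift {q y z : List (IdemE S)} (hq : q ≠ []) (hz : z ≠ [])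
    (K : List (List (IdemE S))) : FactSim (q :: (y ++ z) :: K) ((q ++ y) :: z :: K) := by
  induction y generalizing q with
  | nil => simpa using .refl _
  | cons a y ih =>
    refine .trans _ _ _ (.symm _ _ (.rel _ _ (.shift [] K a hq (y := y ++ z) (by simp [hz])))) ?_
    simpa using ih (q := q ++ [a]) (by simp)

theorem SeedChain.head_eq_append_of_hasSeed {q y R : List (IdemE S)} {K : List (List (IdemE S))}
    (h : SeedChain (factVals (q :: K))) (hK : K.flatten = y ++ R) (hy : y ≠ [])
    (hs : HasSeed (wordVal q * wordVal y)) :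
    ∃ z K', K = (y ++ z) :: K' ∧ ∃ r, wordVal q * wordVal y * r = wordVal q := by
  induction K generalizing q y with
  | nil => simp_all
  | cons k K ih =>
    obtain ⟨h₁, h₂, h₃⟩ := seedChain_cons_cons.1 h
    have short : ∀ z, k = y ++ z →
        ∃ z K', k :: K = (y ++ z) :: K' ∧ ∃ r, wordVal q * wordVal y * r = wordVal q := by
      rintro z rfl
      refine ⟨z, K, rfl, ?_⟩
      rcases hs.split with ⟨-, hr⟩ | ⟨-, w, hw⟩
      · exact hr
      · refine absurd (h₃.head.mul_left (x := wordVal q) (y := w) ?_) h₂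
        rw [wordVal_append, ← mul_assoc (wordVal q), ← mul_assoc w, hw]
    rw [List.flatten_cons] at hK
    obtain ⟨a, rfl, ha⟩ | ⟨a, rfl, -⟩ := List.append_eq_append_iff.1 hK
    · by_cases ha' : a = []
      · exact short [] (by simp [ha'])
      · rw [wordVal_append] at hs
        rcases hs.split with ⟨-, r, hr⟩ | ⟨hs', w, hw⟩
        · exact absurd (h₁.mul_right (y := wordVal a * r) (by simpa only [mul_assoc] using hr)) h₂
        · obtain ⟨-, -, -, r, hr⟩ := ih h₃ ha ha' hs'
          refine absurd (h₃.head.mul_left (x := wordVal q) (y := w) ?_) h₂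
          have := congrArg (· * r) hw
          simpa only [mul_assoc, mul_assoc _ _ r ▸ hr] using this
    · exact short a rfl

theorem SeedChain.move_initial {q y : List (IdemE S)} {K L : List (List (IdemE S))}
    (h : SeedChain (factVals (q :: K))) (h' : SeedChain (factVals ((q ++ y) :: L)))
    (hK : K.flatten = y ++ L.flatten) (hy : y ≠ []) :
    ∃ z K', z ≠ [] ∧ K = (y ++ z) :: K' ∧ SeedChain (factVals ((q ++ y) :: z :: K')) ∧
      z ++ K'.flatten = L.flatten := by
  have hs := h'.head
  rw [wordVal_append] at hs
  obtain ⟨z, K', rfl, r, hr⟩ := h.head_eq_append_of_hasSeed hK hy hs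
  obtain ⟨h₁, h₂, h₃⟩ := seedChain_cons_cons.1 h
  have hyz := h₃.head
  rw [wordVal_append] at hyz
  rcases hyz.split with ⟨-, s, hs⟩ | ⟨hz, w, hw⟩
  · refine absurd (h₁.mul_right (y := s * r) ?_) h₂
    rw [wordVal_append, mul_assoc, ← mul_assoc _ s, hs, ← mul_assoc, hr]
  · refine ⟨z, K', hz.ne_nil, rfl, ?_, by simpa using hK⟩
    refine SeedChain.shift (A := []) h (b := r) (a := wordVal y) (c := wordVal y) (d := w)
      ?_ ?_ ?_ ?_ ?_ <;> simp [hr, hw, mul_assoc]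

theorem SeedChain.factSim_of_flatten_eq {L L' : List (List (IdemE S))}
    (h : SeedChain (factVals L)) (h' : SeedChain (factVals L')) (hL : L.flatten = L'.flatten) :
    FactSim L L' := by
  induction hn : L.length generalizing L L' with
  | zero =>
    obtain rfl := List.eq_nil_of_length_eq_zero hn
    cases L' with
    | nil => exact .refl _
    | cons p L' => exact absurd (by simp_all) (h'.ne_nil List.mem_cons_self)
  | succ n ih =>
    obtain ⟨p, A, rfl⟩ := List.exists_cons_of_length_eq_add_one hn
    rw [List.length_cons, Nat.add_right_cancel_iff] at hn
    have hp := h.ne_nil List.mem_cons_self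
    cases L' with
    | nil => exact absurd (by simp_all) hp
    | cons p' B =>
      have hp' := h'.ne_nil List.mem_cons_self
      have same : p = p' → FactSim (p :: A) (p' :: B) := by
        rintro rfl
        exact factSim_cons p (ih h.tail h'.tail (by simpa using hL) hn)
      rw [List.flatten_cons, List.flatten_cons] at hL
      obtain ⟨y, rfl, hy⟩ | ⟨y, rfl, hy⟩ := List.append_eq_append_iff.1 hL <;>
        by_cases hy' : y = []
      · exact same (by simp [hy'])
      · obtain ⟨z, K, hz, rfl, hc, hf⟩ := h.move_initial h' hy hy'
        exact .trans _ _ _ (factSim_shift hp hz K)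
          (factSim_cons _ (ih hc.tail h'.tail (by simpa using hf) (by simpa using hn)))
      · exact same (by simp [hy'])
      · obtain ⟨z, K, hz, rfl, hc, hf⟩ := h'.move_initial h hy hy'
        exact .trans _ _ _ (factSim_cons _ (ih h.tail hc.tail (by simpa using hf.symm) hn))
          (.symm _ _ (factSim_shift hp' hz K))

theorem exists_seedChain_append {p : List (IdemE S)} {K : List (List (IdemE S))}
    (hp : HasSeed (wordVal p)) (hK : SeedChain (factVals K)) :
    ∃ L, SeedChain (factVals L) ∧ L.flatten = p ++ K.flatten := by
  induction K generalizing p with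
  | nil => exact ⟨[p], seedChain_singleton.2 hp, by simp⟩
  | cons k K ih =>
    by_cases h : HasSeed (wordVal p * wordVal k)
    · obtain ⟨L, hL, hf⟩ := ih (p := p ++ k) (by rwa [wordVal_append]) hK.tail
      exact ⟨L, hL, by simp [hf]⟩
    · exact ⟨p :: k :: K, seedChain_cons_cons.2 ⟨hp, h, hK⟩, by simp⟩

theorem exists_seedChain (w : List (IdemE S)) :
    ∃ L, SeedChain (factVals L) ∧ L.flatten = w := by
  induction w with
  | nil => exact ⟨[], seedChain_nil, rfl⟩
  | cons e w ih =>
    obtain ⟨K, hK, rfl⟩ := ih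
    exact exists_seedChain_append (p := [e]) (by simpa using hasSeed_letterVal e) hK

theorem exists_split_of_flatten_eq {L : List (List (IdemE S))} {u v : List (IdemE S)} {e : IdemE S}
    (h : L.flatten = u ++ e :: v) :
    ∃ A x y C, L = A ++ (x ++ e :: y) :: C ∧ u = A.flatten ++ x ∧ v = y ++ C.flatten := by
  induction L generalizing u with
  | nil => simp at h
  | cons p L ih =>
    rw [List.flatten_cons] at h
    obtain ⟨a, rfl, ha⟩ | ⟨a, rfl, ha⟩ := List.append_eq_append_iff.1 h
    · obtain ⟨A, x, y, C, rfl, rfl, rfl⟩ := ih ha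
      exact ⟨p :: A, x, y, C, rfl, by simp, rfl⟩
    · cases a with
      | nil =>
        obtain ⟨A, x, y, C, rfl, hu, rfl⟩ := ih (u := []) (by simpa using ha.symm)
        obtain ⟨hA, rfl⟩ : A.flatten = [] ∧ x = [] := by simpa [eq_comm] using hu
        exact ⟨(u ++ []) :: A, [], y, C, by simp, by simp [hA], rfl⟩
      | cons b a =>
        obtain ⟨rfl, rfl⟩ : e = b ∧ v = a ++ L.flatten := by simpa using ha
        exact ⟨[], u, a, L, rfl, by simp, rfl⟩

theorem BasicPair.rel_or_rel {e f g : IdemE S} (h : BasicPair e f) (hg : (g : S) = (e : S) * f) :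
    (∃ r, letterVal e * letterVal f * r = letterVal e) ∨
      ∃ r, r * (letterVal e * letterVal f) = letterVal f := by
  have hefg := letterVal_mul h hg
  rcases h with h | h | h | h
  · obtain rfl : g = e := Subtype.ext (hg.trans h)
    exact .inl ⟨1, by simp [hefg]⟩
  · obtain rfl : g = f := Subtype.ext (hg.trans h)
    exact .inr ⟨1, by simp [hefg]⟩
  · refine .inl ⟨letterVal e, ?_⟩
    rw [mul_assoc, letterVal_mul (Or.inr (Or.inl h)) h.symm, letterVal_mul_self]
  · refine .inr ⟨letterVal f, ?_⟩
    rw [← mul_assoc, letterVal_mul (Or.inl h) h.symm, letterVal_mul_self]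

theorem SeedChain.exists_of_contracts {w w' : List (IdemE S)} {L : List (List (IdemE S))}
    (hc : Contracts w w') (h : SeedChain (factVals L)) (hL : L.flatten = w) :
    ∃ L', SeedChain (factVals L') ∧ L'.flatten = w' ∧ FactSim L L' := by
  obtain ⟨u, v, e, f, g, hb, hg, rfl, rfl⟩ := hc
  have hefg := letterVal_mul hb hg
  obtain ⟨A, x, y, C, rfl, rfl, hv⟩ := exists_split_of_flatten_eq hL
  cases y with
  | cons f' y =>
    obtain ⟨rfl, rfl⟩ : f = f' ∧ v = y ++ C.flatten := by simpa using hv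
    have hval : wordVal (x ++ e :: f :: y) = wordVal (x ++ g :: y) := by
      simp [← hefg, mul_assoc]
    refine ⟨A ++ (x ++ g :: y) :: C, ?_, by simp, .rel _ _ (.congr A C (by simp) (by simp) hval)⟩
    simpa only [factVals, List.map_append, List.map_cons, hval] using h
  | nil =>
    cases C with
    | nil => simp at hv
    | cons q C =>
      have hq := h.ne_nil (x := q) (by simp)
      obtain ⟨f', z, rfl⟩ := List.exists_cons_of_ne_nil hq
      obtain ⟨rfl, rfl⟩ : f = f' ∧ v = z ++ C.flatten := by simpa using hv
      have h' := h
      simp only [factVals, List.map_append, List.map_cons] at h'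
      obtain ⟨h₁, h₂, h₃⟩ := seedChain_cons_cons.1 h'.append_right
      simp only [wordVal_append, wordVal_cons, wordVal_nil, mul_one] at h₁ h₂ h₃
      rcases hb.rel_or_rel hg with ⟨r, hr⟩ | ⟨r, hr⟩
      · rcases h₃.head.split with ⟨-, s, hs⟩ | ⟨hz, s, hs⟩
        · refine absurd (h₁.mul_right (y := s * r) ?_) h₂
          rw [mul_assoc, ← mul_assoc _ s, hs, mul_assoc, ← mul_assoc (letterVal e), hr]
        · refine ⟨A ++ (x ++ [g]) :: z :: C, ?_, by simp, ?_⟩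
          · simp only [factVals, List.map_append, List.map_cons]
            refine h'.shift (b := r) (a := letterVal f) (c := letterVal f) (d := s)
              ?_ ?_ ?_ ?_ ?_ <;> simp [← hefg, hs, mul_assoc]
            rw [← mul_assoc (letterVal e), hr]
          · refine .trans _ (A ++ (x ++ [e] ++ [f]) :: z :: C) _
              (.symm _ _ (.rel _ _ (.shift A C f (by simp) hz.ne_nil)))
              (.rel _ _ (.congr A _ (by simp) (by simp) ?_))
            simp [← hefg]
      · rcases h₁.split with ⟨hx, s, hs⟩ | ⟨-, s, hs⟩
        · refine ⟨A ++ x :: (g :: z) :: C, ?_, by simp, ?_⟩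
          · simp only [factVals, List.map_append, List.map_cons]
            refine h'.shift (b := letterVal e) (a := s) (c := r) (d := letterVal e)
              ?_ ?_ ?_ ?_ ?_ <;> simp [← hefg, hs, mul_assoc]
            rw [← mul_assoc (letterVal e), ← mul_assoc, hr]
          · refine .trans _ (A ++ x :: (e :: f :: z) :: C) _
              (.rel _ _ (.shift A C e hx.ne_nil (by simp))) ?_
            have := FactStep.congr (A ++ [x]) C (x := e :: f :: z) (y := g :: z) (by simp) (by simp)
              (by simp [← hefg, mul_assoc])
            exact .rel _ _ (by simpa using this)
        · refine absurd (h₃.head.mul_left (x := wordVal x * letterVal e) (y := r * s) ?_) h₂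
          rw [← mul_assoc (_ * letterVal e), mul_assoc r, ← mul_assoc s, ← mul_assoc s, hs,
            ← mul_assoc, hr]

theorem SeedChain.exists_of_contracts_symm {w w' : List (IdemE S)} {L : List (List (IdemE S))}
    (hc : Contracts w w') (h : SeedChain (factVals L)) (hL : L.flatten = w') :
    ∃ L', SeedChain (factVals L') ∧ L'.flatten = w ∧ FactSim L L' := by
  obtain ⟨u, v, e, f, g, hb, hg, rfl, rfl⟩ := hc
  obtain ⟨A, x, y, C, rfl, rfl, rfl⟩ := exists_split_of_flatten_eq hL
  have hval : wordVal (x ++ g :: y) = wordVal (x ++ e :: f :: y) := by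
    simp [← letterVal_mul hb hg, mul_assoc]
  refine ⟨A ++ (x ++ e :: f :: y) :: C, ?_, by simp,
    .rel _ _ (.congr A C (by simp) (by simp) hval)⟩
  simpa only [factVals, List.map_append, List.map_cons, hval] using h

theorem SeedChain.factSim_of_wordVal_eq {L L' : List (List (IdemE S))}
    (h : SeedChain (factVals L)) (h' : SeedChain (factVals L'))
    (hL : wordVal L.flatten = wordVal L'.flatten) : FactSim L L' := by
  suffices ∀ w w', Relation.EqvGen Contracts w w' →
      (∀ L : List (List (IdemE S)), SeedChain (factVals L) → L.flatten = w →
        ∃ L', SeedChain (factVals L') ∧ L'.flatten = w' ∧ FactSim L L') ∧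
      (∀ L : List (List (IdemE S)), SeedChain (factVals L) → L.flatten = w' →
        ∃ L', SeedChain (factVals L') ∧ L'.flatten = w ∧ FactSim L L') by
    obtain ⟨K, hK, hf, hs⟩ := (this _ _ (eqvGen_contracts_of_wordVal_eq hL)).1 L h rfl
    exact .trans _ _ _ hs (hK.factSim_of_flatten_eq h' hf)
  intro w w' hw
  induction hw with
  | rel _ _ hc =>
    exact ⟨fun _ h hL => h.exists_of_contracts hc hL, fun _ h hL => h.exists_of_contracts_symm hc hL⟩
  | refl _ => exact ⟨fun L h hL => ⟨L, h, hL, .refl _⟩, fun L h hL => ⟨L, h, hL, .refl _⟩⟩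
  | symm _ _ _ ih => exact ih.symm
  | trans _ _ _ _ _ ih₁ ih₂ =>
    constructor
    · intro L h hL
      obtain ⟨L₁, h₁, hL₁, hs₁⟩ := ih₁.1 L h hL
      obtain ⟨L₂, h₂, hL₂, hs₂⟩ := ih₂.1 L₁ h₁ hL₁
      exact ⟨L₂, h₂, hL₂, .trans _ _ _ hs₁ hs₂⟩
    · intro L h hL
      obtain ⟨L₁, h₁, hL₁, hs₁⟩ := ih₂.2 L h hL
      obtain ⟨L₂, h₂, hL₂, hs₂⟩ := ih₁.2 L₁ h₁ hL₁
      exact ⟨L₂, h₂, hL₂, .trans _ _ _ hs₁ hs₂⟩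

end Factorisations

section Regularity

variable {S : Type*} [Semigroup S]

theorem lift_eq_of_igBar_eq {u v : FreeSemigroup (IdemE S)} (h : igBar u = igBar v) :
    FreeSemigroup.lift (Subtype.val : IdemE S → S) u = FreeSemigroup.lift Subtype.val v := by
  have hle : igCon S ≤ Con.ker (FreeSemigroup.lift (Subtype.val : IdemE S → S)) := by
    refine Con.conGen_le.2 ?_
    rintro _ _ ⟨e, f, g, -, hg, rfl, rfl⟩
    simp [Con.ker_rel, hg]
  exact hle ((Con.eq _).1 h)

theorem exists_letterVal_of_mul_mul_eq {e h : IdemE S} {r : WithOne (IG S)}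
    (hr : letterVal e * letterVal h * r = letterVal e) :
    ∃ z : IdemE S, (∃ p, p * (letterVal e * letterVal h) = letterVal z) ∧
      letterVal e * letterVal z = letterVal e * letterVal h := by
  revert hr
  refine WithOne.cases_on r (fun hr => ⟨e, ⟨1, ?_⟩, ?_⟩) fun b => Con.induction_on b fun w hr => ?_
  · rw [one_mul, ← mul_one (_ * letterVal h), hr]
  · rw [letterVal_mul_self, ← mul_one (_ * letterVal h), hr]
  have hS := lift_eq_of_igBar_eq (u := FreeSemigroup.of e * FreeSemigroup.of h * w)
    (v := FreeSemigroup.of e) (WithOne.coe_inj.1 hr)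
  simp only [map_mul, FreeSemigroup.lift_of] at hS
  set ρ : S := FreeSemigroup.lift Subtype.val w
  have hey : (e : S) * (h * ρ * e) = e := by rw [← mul_assoc, ← mul_assoc, hS, e.2]
  have hye : (h * ρ * e : S) * e = h * ρ * e := by rw [mul_assoc, e.2]
  have hhy : (h : S) * (h * ρ * e) = h * ρ * e := by rw [← mul_assoc, ← mul_assoc, h.2]
  have hyy : (h * ρ * e : S) * (h * ρ * e) = h * ρ * e := by
    rw [mul_assoc _ (e : S), hey]
  have hzz : (h * ρ * e * h : S) * (h * ρ * e * h) = h * ρ * e * h := by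
    rw [mul_assoc _ (h : S), ← mul_assoc (h : S) _ (h : S), hhy, ← mul_assoc, hyy]
  let y : IdemE S := ⟨h * ρ * e, hyy⟩
  let z : IdemE S := ⟨h * ρ * e * h, hzz⟩
  have h₁ : letterVal e * letterVal y = letterVal e := letterVal_mul (.inl hey) hey.symm
  have h₂ : letterVal y * letterVal e = letterVal y := letterVal_mul (.inl hye) hye.symm
  have h₃ : letterVal y * letterVal h = letterVal z := letterVal_mul (.inr (.inr (.inl hhy))) rfl
  exact ⟨z, ⟨letterVal y, by rw [← mul_assoc, h₂, h₃]⟩, by rw [← h₃, ← mul_assoc, h₁]⟩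

theorem exists_letterVal_of_mul_wordVal_eq {e : IdemE S} {v : List (IdemE S)} {s : WithOne (IG S)}
    (hs : letterVal e * wordVal v * s = letterVal e) :
    ∃ (f : IdemE S) (x y : WithOne (IG S)), x * (letterVal e * wordVal v) = letterVal f ∧
      y * letterVal f = letterVal e * wordVal v := by
  induction v generalizing e s with
  | nil => exact ⟨e, 1, 1, by simp, by simp⟩
  | cons h v ih =>
    obtain ⟨z, ⟨p, hp⟩, hz⟩ := exists_letterVal_of_mul_mul_eq (e := e) (h := h)
      (r := wordVal v * s) (by simpa only [wordVal_cons, mul_assoc] using hs)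
    obtain ⟨f, x, y, hx, hy⟩ := ih (e := z) (s := s * letterVal h) (by
      rw [← hp]
      have := congrArg (fun t => p * t * letterVal h) hs
      simpa only [wordVal_cons, mul_assoc] using this)
    refine ⟨f, x * p, letterVal e * y, ?_, ?_⟩
    · rw [← hx, ← hp, wordVal_cons]
      simp only [mul_assoc]
    · rw [mul_assoc, hy, ← mul_assoc, hz, wordVal_cons, mul_assoc]

theorem HasSeed.exists_letterVal {a : WithOne (IG S)} (h : HasSeed a) :
    ∃ (f : IdemE S) (x y : WithOne (IG S)), x * a = letterVal f ∧ y * letterVal f = a := by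
  obtain ⟨w, rfl, u, e, v, rfl, ⟨t, ht⟩, s, hs⟩ := h
  obtain ⟨f, x, y, hx, hy⟩ := exists_letterVal_of_mul_wordVal_eq hs
  refine ⟨f, x * t, wordVal u * y, ?_, ?_⟩
  · rw [wordVal_append, wordVal_cons, ← hx, mul_assoc x, ← mul_assoc t, ← mul_assoc (t * _), ht]
  · rw [mul_assoc, hy, wordVal_append, wordVal_cons]

theorem HasSeed.exists_mul_mul_self {a : WithOne (IG S)} (h : HasSeed a) :
    ∃ b, a * b * a = a := by
  obtain ⟨w, rfl, u, e, v, rfl, ⟨t, ht⟩, s, hs⟩ := h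
  refine ⟨s * t, ?_⟩
  simp only [wordVal_append, wordVal_cons]
  calc _ = wordVal u * (letterVal e * wordVal v * s) * (t * wordVal u * letterVal e) * wordVal v := by
        simp only [mul_assoc]
    _ = _ := by rw [hs, ht, mul_assoc (wordVal u), letterVal_mul_self, mul_assoc]

theorem exists_isInfix_of_flatten_replicate {α : Type*} {L : List (List α)} {c w : List α} {n : ℕ}
    (hw : w ≠ []) (hn : L.length ≤ n) (hn' : n ≠ 0)
    (h : L.flatten = c ++ (List.replicate n w).flatten) : ∃ r ∈ L, w <:+: r := by
  obtain ⟨n, rfl⟩ := Nat.exists_eq_succ_of_ne_zero hn'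
  induction L generalizing c n with
  | nil => simp_all [List.replicate_succ]
  | cons r L ih =>
    rw [List.flatten_cons] at h
    obtain ⟨s, rfl, hs⟩ | ⟨s, rfl, hs⟩ := List.append_eq_append_iff.1 h
    · obtain ⟨r', hr, hi⟩ := ih n (by simp at hn ⊢; omega) hn' hs
      exact ⟨r', by simp [hr], hi⟩
    · rw [List.replicate_succ, List.flatten_cons] at hs
      obtain ⟨s', rfl, hs'⟩ | ⟨s', rfl, hs'⟩ := List.append_eq_append_iff.1 hs
      · exact ⟨c ++ (w ++ s'), by simp, c, s', by simp⟩
      · cases n with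
        | zero =>
          obtain rfl : L = [] := by simpa using hn
          obtain rfl : s' = [] := by simpa [eq_comm] using hs'
          exact ⟨c ++ s, by simp, c, [], by simp⟩
        | succ n =>
          obtain ⟨r', hr, hi⟩ := ih n (by simpa using hn) (by simp) hs'
          exact ⟨r', by simp [hr], hi⟩

theorem exists_hasSeed_of_idempotent {g : WithOne (IG S)} (hg : g * g = g) (hg' : g ≠ 1) :
    ∃ a b x y, HasSeed (a * g * b) ∧ x * (a * g * b) * y = g := by
  obtain ⟨w, rfl⟩ := exists_wordVal g
  obtain ⟨L, hL, hf⟩ := exists_seedChain w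
  have hw : w ≠ [] := by rintro rfl; exact hg' rfl
  have hn : L.length ≠ 0 := by
    rintro h
    obtain rfl := List.eq_nil_of_length_eq_zero h
    exact hw hf.symm
  have hpow : ∀ n, wordVal (List.replicate (n + 1) w).flatten = wordVal w := by
    intro n
    induction n with
    | zero => simp
    | succ n ih => rw [List.replicate_succ, List.flatten_cons, wordVal_append, ih, hg]
  obtain ⟨K, hK, hKf⟩ := exists_seedChain (List.replicate L.length w).flatten
  have hval : wordVal K.flatten = wordVal w := by
    rw [hKf, ← Nat.succ_pred_eq_of_ne_zero hn, Nat.succ_eq_add_one, hpow]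
  have hlen := (hK.factSim_of_wordVal_eq hL (by rw [hval, hf])).length_eq
  obtain ⟨r, hr, a, b, rfl⟩ := exists_isInfix_of_flatten_replicate (c := []) hw hlen.le hn hKf
  obtain ⟨A, C, rfl⟩ := List.append_of_mem hr
  refine ⟨wordVal a, wordVal b, wordVal A.flatten, wordVal C.flatten, ?_, ?_⟩
  · simpa [mul_assoc] using hK.1 _ (List.mem_map_of_mem hr)
  · simpa [mul_assoc] using hval

theorem hasSeed_of_idempotent [Finite (IdemE S)] {g : WithOne (IG S)} (hg : g * g = g)
    (hg' : g ≠ 1) : HasSeed g := by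
  obtain ⟨k, x, y, hk, hkk, hgk, hkg, hxy⟩ : ∃ k x y, HasSeed k ∧ k * k = k ∧ g * k = k ∧
      k * g = k ∧ x * k * y = g := by
    obtain ⟨A, B, X, Y, ⟨w, hw, u, e, v, rfl, ⟨t, ht⟩, s, hs⟩, hXY⟩ :=
      exists_hasSeed_of_idempotent hg hg'
    simp only [wordVal_append, wordVal_cons] at hw
    have hz : t * A * g * (B * s) = letterVal e := by
      calc _ = t * (A * g * B) * s := by simp only [mul_assoc]
        _ = t * wordVal u * letterVal e * wordVal v * s := by rw [← hw]; simp only [mul_assoc]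
        _ = _ := by rw [ht, hs]
    have he := letterVal_mul_self e
    have hseed := hasSeed_letterVal e
    generalize letterVal e = e at hw hz he hseed
    generalize t * A = z, B * s = t at hz
    have hz' : ∀ r, z * (g * (t * r)) = e * r := fun r => by rw [← hz]; simp only [mul_assoc]
    have he' : ∀ r, e * (e * r) = e * r := fun r => by rw [← mul_assoc, he]
    have hg' : ∀ r, g * (g * r) = g * r := fun r => by rw [← mul_assoc, hg]
    refine ⟨g * (t * (e * (z * g))), X * (wordVal u * z), t * (wordVal v * Y), ?_, ?_, ?_, ?_, ?_⟩
    · have h₁ : HasSeed (e * (z * g)) := hseed.mul_right (y := t * e) (by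
        simp only [mul_assoc, hz', he])
      simpa only [mul_assoc] using h₁.mul_left (x := g * t) (y := e * z) (by
        simp only [mul_assoc, hz', he'])
    · simp only [mul_assoc, hz', hg', he']
    · rw [hg']
    · simp only [mul_assoc, hg]
    · refine Eq.trans ?_ hXY
      simp only [← hw, mul_assoc, hz', he']
  obtain ⟨a, c, hac, hga, hag, hgc, hcg, hak, hkc⟩ : ∃ a c, a * c = g ∧ g * a = a ∧ a * g = a ∧
      g * c = c ∧ c * g = c ∧ a * k = a ∧ k * c = c := by
    refine ⟨g * x * k, k * y * g, ?_, ?_, ?_, ?_, ?_, ?_, ?_⟩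
    · simp only [← mul_assoc, mul_assoc _ k k, hkk]
      rw [mul_assoc g, mul_assoc g, hxy, hg, hg]
    · simp only [← mul_assoc, hg]
    · simp only [mul_assoc, hkg]
    · simp only [← mul_assoc, hgk]
    · simp only [mul_assoc, hg]
    · simp only [mul_assoc, hkk]
    · simp only [← mul_assoc, hkk]
  let K : ℕ → WithOne (IG S) := fun n => c ^ n * k * a ^ n
  have hsucc : ∀ n, K (n + 1) = c * K n * a := fun n => by
    simp only [K, pow_succ' c, pow_succ a, mul_assoc]
  have h₀ : K 0 = k := by simp [K]
  have hgK : ∀ n, g * K n = K n := by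
    rintro (_ | n)
    · rw [h₀, hgk]
    · simp only [hsucc, ← mul_assoc, hgc]
  have hKg : ∀ n, K n * g = K n := by
    rintro (_ | n)
    · rw [h₀, hkg]
    · simp only [hsucc, mul_assoc, hag]
  have hmul : ∀ m n, K (m + 1) * K (n + 1) = c * (K m * K n) * a := by
    intro m n
    calc _ = c * (K m * (a * c) * K n) * a := by simp only [hsucc, mul_assoc]
      _ = _ := by rw [hac, hKg]
  have hpred : ∀ n, a * K (n + 1) * c = K n := by
    intro n
    calc _ = a * c * K n * (a * c) := by simp only [hsucc, mul_assoc]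
      _ = _ := by rw [hac, hgK, hKg]
  have hidem : ∀ n, K n * K n = K n := by
    intro n
    induction n with
    | zero => rw [h₀, hkk]
    | succ n ih => rw [hmul, ih, hsucc]
  have hright : ∀ n, K n * K (n + 1) = K (n + 1) := by
    intro n
    induction n with
    | zero => simp only [hsucc, h₀, ← mul_assoc, hkc]
    | succ n ih => rw [hmul, ih, hsucc (n + 1)]
  have hleft : ∀ n, K (n + 1) * K n = K (n + 1) := by
    intro n
    induction n with
    | zero => simp only [hsucc, h₀, mul_assoc, hak]
    | succ n ih => rw [hmul, ih, hsucc (n + 1)]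
  have hseed : ∀ n, HasSeed (K n) := by
    intro n
    induction n with
    | zero => rwa [h₀]
    | succ n ih =>
      have h₁ : HasSeed (K n * a) := ih.mul_right (y := c) (by rw [mul_assoc, hac, hKg])
      rw [hsucc, mul_assoc]
      exact h₁.mul_left (y := a) (by rw [← mul_assoc, hac, ← mul_assoc, hgK])
  have hle : ∀ i j, i ≤ j → K i * K j = K j := by
    intro i j hij
    induction j, hij using Nat.le_induction with
    | base => exact hidem i
    | succ j _ ih => rw [← hright j, ← mul_assoc, ih]
  choose f p q hp hq using fun n => (hseed n).exists_letterVal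
  obtain ⟨i, j, hij, hf⟩ := Finite.exists_ne_map_eq_of_infinite f
  wlog hlt : i < j generalizing i j
  · exact this j i hij.symm hf.symm (by omega)
  have h₁ : K i * K j = K i := by
    rw [← hq i, hf, ← hp j, mul_assoc, mul_assoc, hidem j]
  have h₂ : K i = K (i + 1) := by
    rw [← hleft i, ← h₁, hle i j hlt.le, hle _ j hlt]
  have h₃ : ∀ n, K n = K (n + 1) → K 0 = K 1 := by
    intro n
    induction n with
    | zero => exact id
    | succ n ih =>
      intro h
      apply ih
      rw [← hpred n, h, hpred (n + 1), h]
  have h₄ := hpred 0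
  rw [← h₃ i h₂, h₀, hak, hac] at h₄
  rwa [h₄]

theorem isRegularElem_iff_hasSeed [Finite (IdemE S)] (w : FreeSemigroup (IdemE S)) :
    IsRegularElem (igBar w) ↔ HasSeed (wordVal (wordList w)) := by
  rw [wordVal_wordList]
  generalize igBar w = a
  constructor
  · rintro ⟨b, h⟩
    have h' : (a : WithOne (IG S)) * (b : WithOne (IG S)) * a = a := congrArg _ h
    have hs : HasSeed ((a : WithOne (IG S)) * (b : WithOne (IG S))) :=
      hasSeed_of_idempotent (by rw [← mul_assoc, h']) WithOne.coe_ne_one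
    rw [← h']
    exact hs.mul_right (y := b) (by rw [h'])
  · intro h
    obtain ⟨b, hb⟩ := h.exists_mul_mul_self
    revert hb
    refine WithOne.cases_on b (fun hb => ⟨a, ?_⟩) fun b hb => ⟨b, WithOne.coe_inj.1 hb⟩
    rw [mul_one] at hb
    have : a * a = a := WithOne.coe_inj.1 hb
    rw [this, this]

end Regularity

section Tuples

variable {S : Type*} [Semigroup S]

/-- The list of the words `p i, …, p (i + n - 1)`. -/
def factList (p : ℕ → FreeSemigroup (IdemE S)) (i n : ℕ) : List (List (IdemE S)) :=
  (List.range' i n).map fun j => wordList (p j)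

@[simp] theorem length_factList (p : ℕ → FreeSemigroup (IdemE S)) (i n : ℕ) :
    (factList p i n).length = n := by simp [factList]

theorem factList_add (p : ℕ → FreeSemigroup (IdemE S)) (i m n : ℕ) :
    factList p i (m + n) = factList p i m ++ factList p (i + m) n := by
  rw [factList, ← List.range'_append_1, List.map_append]
  rfl

theorem wordList_blockProd (p : ℕ → FreeSemigroup (IdemE S)) (i k : ℕ) :
    wordList (blockProd p i k) = (factList p i (k + 1)).flatten := by
  induction k with
  | zero => simp [factList, blockProd]
  | succ k ih =>
    rw [blockProd, wordList_mul, ih, factList_add p i (k + 1) 1]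
    simp [factList]

theorem igBar_eq_iff {u v : FreeSemigroup (IdemE S)} :
    igBar u = igBar v ↔ wordVal (wordList u) = wordVal (wordList v) := by
  rw [wordVal_wordList, wordVal_wordList, WithOne.coe_inj]

theorem SeedChain.of_isInfix {V W : List (WithOne (IG S))} (h : SeedChain V) (hW : W <:+: V) :
    SeedChain W := by
  obtain ⟨A, B, rfl⟩ := hW
  exact ⟨fun a ha => h.1 a (by simp [ha]), h.2.left_of_append.right_of_append⟩

theorem isMinRFact_iff [Finite (IdemE S)] {w : FreeSemigroup (IdemE S)} {m : ℕ}
    {p : ℕ → FreeSemigroup (IdemE S)} : IsMinRFact w m p ↔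
      1 ≤ m ∧ SeedChain (factVals (factList p 1 m)) ∧ (factList p 1 m).flatten = wordList w := by
  have hflat : 1 ≤ m → (blockProd p 1 (m - 1) = w ↔ (factList p 1 m).flatten = wordList w) := by
    intro hm
    rw [← wordList_injective.eq_iff, wordList_blockProd, Nat.sub_add_cancel hm]
  constructor
  · rintro ⟨⟨hm, hw, hr⟩, hmin⟩
    refine ⟨hm, ⟨?_, ?_⟩, (hflat hm).1 hw⟩
    · simp only [factVals, factList, List.map_map, List.mem_map, List.mem_range'_1]
      rintro _ ⟨i, hi, rfl⟩
      exact (isRegularElem_iff_hasSeed _).1 (hr i hi.1 (by omega))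
    · rw [List.isChain_iff_getElem]
      intro i hi
      simp only [factVals, List.length_map, length_factList] at hi
      have := hmin (1 + i) (1 + (i + 1)) (by omega) (by omega) (by omega)
      rw [isRegularElem_iff_hasSeed, wordList_blockProd, show 1 + (i + 1) - (1 + i) = 1 by omega]
        at this
      simpa [factList, List.range'_succ, add_assoc] using this
  · rintro ⟨hm, hc, hf⟩
    refine ⟨⟨hm, (hflat hm).2 hf, fun i h₁ h₂ => ?_⟩, fun i j h₁ h₂ h₃ => ?_⟩
    · rw [isRegularElem_iff_hasSeed]
      refine hc.1 _ (List.mem_map_of_mem (List.mem_map_of_mem (List.mem_range'_1.2 ⟨h₁, by omega⟩)))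
    · rw [isRegularElem_iff_hasSeed, wordList_blockProd, ← prod_factVals]
      have hin : factList p i (j - i + 1) <:+: factList p 1 m := by
        refine ⟨factList p 1 (i - 1), factList p (j + 1) (m - j), ?_⟩
        have e₁ := factList_add p 1 (i - 1) (j - i + 1)
        have e₂ := factList_add p 1 (i - 1 + (j - i + 1)) (m - j)
        rw [Nat.add_sub_cancel' h₁] at e₁
        rw [show i - 1 + (j - i + 1) + (m - j) = m by omega,
          show 1 + (i - 1 + (j - i + 1)) = j + 1 by omega, e₁] at e₂
        exact e₂.symm
      have hc' := hc.of_isInfix (hin.map wordVal)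
      rw [add_comm, factList_add, show factList p i 1 = [wordList (p i)] from rfl] at hc' ⊢
      refine hc'.not_hasSeed_prod fun h => ?_
      have := congrArg List.length h
      simp at this
      omega

/-- The tuple of the words in a list; entries out of range are sent to `d`. -/
def tupleOfList (d : FreeSemigroup (IdemE S)) (L : List (List (IdemE S))) (i : ℕ) :
    FreeSemigroup (IdemE S) := wordOfList d (L.getD (i - 1) [])

theorem factList_tupleOfList (d : FreeSemigroup (IdemE S)) {L : List (List (IdemE S))}
    (h : ∀ x ∈ L, x ≠ []) : factList (tupleOfList d L) 1 L.length = L := by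
  refine List.ext_getElem (by simp) fun i h₁ h₂ => ?_
  simp only [factList, List.getElem_map, List.getElem_range', tupleOfList, mul_comm 1,
    mul_one, Nat.add_sub_cancel_left, List.getD_eq_getElem _ _ h₂]
  exact wordList_wordOfList d (h _ (List.getElem_mem h₂))

theorem tupleOfList_factList (d : FreeSemigroup (IdemE S)) (p : ℕ → FreeSemigroup (IdemE S))
    {i m : ℕ} (h₁ : 1 ≤ i) (h₂ : i ≤ m) : tupleOfList d (factList p 1 m) i = p i := by
  have hi : i - 1 < (factList p 1 m).length := by simp; omega
  rw [tupleOfList, List.getD_eq_getElem _ _ hi]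
  simp only [factList, List.getElem_map, List.getElem_range', one_mul, Nat.add_sub_cancel' h₁]
  exact wordOfList_wordList d (p i)

theorem igBar_wordOfList {d : FreeSemigroup (IdemE S)} {x y : List (IdemE S)} (hx : x ≠ [])
    (hy : y ≠ []) (h : wordVal x = wordVal y) :
    igBar (wordOfList d x) = igBar (wordOfList d y) := by
  rwa [igBar_eq_iff, wordList_wordOfList d hx, wordList_wordOfList d hy]

theorem tupleApprox_of_agree {m : ℕ} {p q : ℕ → FreeSemigroup (IdemE S)} (hm : 1 ≤ m)
    (h : ∀ j, 1 ≤ j → j ≤ m → p j = q j) : TupleApprox m p q :=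
  .inl ⟨1, le_rfl, hm, by rw [h 1 le_rfl hm], fun j h₁ h₂ _ => h j h₁ h₂⟩

theorem TupleApprox.symm {m : ℕ} {p q : ℕ → FreeSemigroup (IdemE S)} (h : TupleApprox m p q) :
    TupleApprox m q p := by
  rcases h with ⟨i, h₁, h₂, h₃, h₄⟩ | ⟨i, e, h₁, h₂, h₃, h₄, h₅⟩ | ⟨i, e, h₁, h₂, h₃, h₄, h₅⟩
  · exact .inl ⟨i, h₁, h₂, h₃.symm, fun j a b c => (h₄ j a b c).symm⟩
  · exact .inr (.inr ⟨i, e, h₁, h₂, h₃, h₄, fun j a b c d => (h₅ j a b c d).symm⟩)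
  · exact .inr (.inl ⟨i, e, h₁, h₂, h₃, h₄, fun j a b c d => (h₅ j a b c d).symm⟩)

instance (m : ℕ) : Std.Symm (TupleApprox (S := S) m) := ⟨fun _ _ => TupleApprox.symm⟩

theorem FactStep.tupleApprox (d : FreeSemigroup (IdemE S)) {L L' : List (List (IdemE S))}
    (h : FactStep L L') : TupleApprox L.length (tupleOfList d L) (tupleOfList d L') := by
  cases h with
  | @congr A C x y hx hy h =>
    refine .inl ⟨A.length + 1, by simp, by simp, ?_, fun j h₁ h₂ hj => ?_⟩
    · simpa [tupleOfList] using igBar_wordOfList hx hy h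
    · rcases lt_or_gt_of_ne hj with hj | hj
      · simp [tupleOfList, List.getElem?_append_left (show j - 1 < A.length by omega)]
      · obtain ⟨k, rfl⟩ : ∃ k, j = A.length + (k + 1) + 1 := ⟨j - A.length - 2, by omega⟩
        simp [tupleOfList, List.getElem?_append_right]
  | @shift A C x y f hx hy =>
    refine .inr (.inl ⟨A.length + 1, f, by simp, by simp, ?_, ?_, fun j h₁ h₂ hj hj' => ?_⟩)
    · simp only [igBar_eq_iff, tupleOfList]
      simp [wordList_mul, wordList_of, wordList_wordOfList d hx,
        wordList_wordOfList d (show x ++ [f] ≠ [] by simp)]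
    · simp only [igBar_eq_iff, tupleOfList]
      simp [wordList_mul, wordList_of, wordList_wordOfList d hy,
        wordList_wordOfList d (show f :: y ≠ [] by simp)]
    · rcases lt_or_gt_of_ne hj with hj | hj
      · simp [tupleOfList, List.getElem?_append_left (show j - 1 < A.length by omega)]
      · obtain ⟨k, rfl⟩ : ∃ k, j = A.length + (k + 2) + 1 := ⟨j - A.length - 3, by omega⟩
        simp [tupleOfList, List.getElem?_append_right]

theorem FactSim.tupleSim (d : FreeSemigroup (IdemE S)) {L L' : List (List (IdemE S))}
    (h : FactSim L L') (hL : L ≠ []) :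
    TupleSim L.length (tupleOfList d L) (tupleOfList d L') := by
  induction h with
  | rel _ _ h => exact .single (h.tupleApprox d)
  | refl L => exact .single (tupleApprox_of_agree (List.length_pos_iff.2 hL) fun _ _ _ => rfl)
  | symm L L' h ih =>
    have hlen := FactSim.length_eq h
    rw [← hlen]
    exact Relation.TransGen.stdSymm.symm _ _
      (ih fun h₀ => hL (List.eq_nil_of_length_eq_zero (by simp [← hlen, h₀])))
  | trans L L' _ h _ ih₁ ih₂ =>
    have hlen := FactSim.length_eq h
    refine (ih₁ hL).trans ?_
    rw [hlen]
    exact ih₂ fun h₀ => hL (List.eq_nil_of_length_eq_zero (by simp [hlen, h₀]))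

theorem factVals_factList (p : ℕ → FreeSemigroup (IdemE S)) (i n : ℕ) :
    factVals (factList p i n) =
      (List.range' i n).map fun j => ((igBar (p j) : IG S) : WithOne (IG S)) := by
  simp [factVals, factList, wordVal_wordList]

theorem TupleApprox.prod_eq {m : ℕ} {p q : ℕ → FreeSemigroup (IdemE S)} (h : TupleApprox m p q) :
    (factVals (factList p 1 m)).prod = (factVals (factList q 1 m)).prod := by
  have key : ∀ (i : ℕ) (e : IdemE S) (p q : ℕ → FreeSemigroup (IdemE S)), 1 ≤ i → i < m →
      igBar (p i) = igBar (q i * FreeSemigroup.of e) →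
      igBar (q (i + 1)) = igBar (FreeSemigroup.of e * p (i + 1)) →
      (∀ j, 1 ≤ j → j ≤ m → j ≠ i → j ≠ i + 1 → p j = q j) →
      (factVals (factList p 1 m)).prod = (factVals (factList q 1 m)).prod := by
    intro i e p q h₁ h₂ hp hq h
    obtain ⟨a, rfl⟩ := Nat.exists_eq_add_of_le h₁
    obtain ⟨b, rfl⟩ : ∃ b, m = a + (2 + b) := ⟨m - a - 2, by omega⟩
    have hA : factVals (factList p 1 a) = factVals (factList q 1 a) := by
      rw [factVals_factList, factVals_factList]
      refine List.map_congr_left fun j hj => ?_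
      rw [List.mem_range'_1] at hj
      rw [h j (by omega) (by omega) (by omega) (by omega)]
    have hB : factVals (factList p (1 + a + 2) b) = factVals (factList q (1 + a + 2) b) := by
      rw [factVals_factList, factVals_factList]
      refine List.map_congr_left fun j hj => ?_
      rw [List.mem_range'_1] at hj
      rw [h j (by omega) (by omega) (by omega) (by omega)]
    have h2 : (factVals (factList p (1 + a) 2)).prod = (factVals (factList q (1 + a) 2)).prod := by
      simp [factVals_factList, List.range'_succ, hp, hq, igBar_mul, mul_assoc]
    simp only [factList_add, factVals, List.map_append, List.prod_append] at hA hB h2 ⊢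
    rw [hA, hB, h2]
  rcases h with ⟨i, -, -, h₃, h₄⟩ | ⟨i, e, h₁, h₂, h₃, h₄, h₅⟩ | ⟨i, e, h₁, h₂, h₃, h₄, h₅⟩
  · rw [factVals_factList, factVals_factList]
    congr 1
    refine List.map_congr_left fun j hj => ?_
    rw [List.mem_range'_1] at hj
    by_cases hji : j = i
    · rw [hji, h₃]
    · rw [h₄ j (by omega) (by omega) hji]
  · exact key i e p q h₁ h₂ h₃ h₄ h₅
  · exact (key i e q p h₁ h₂ h₃ h₄ fun j a b c d => (h₅ j a b c d).symm).symm

theorem TupleSim.prod_eq {m : ℕ} {p q : ℕ → FreeSemigroup (IdemE S)} (h : TupleSim m p q) :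
    (factVals (factList p 1 m)).prod = (factVals (factList q 1 m)).prod := by
  induction h with
  | single h => exact h.prod_eq
  | tail _ h ih => exact ih.trans h.prod_eq

variable [Finite (IdemE S)]

theorem exists_isMinRFact (w : FreeSemigroup (IdemE S)) : ∃ m p, IsMinRFact w m p := by
  obtain ⟨L, hL, hf⟩ := exists_seedChain (wordList w)
  have h := factList_tupleOfList w fun _ => hL.ne_nil
  refine ⟨L.length, tupleOfList w L, isMinRFact_iff.2 ⟨?_, by rwa [h], by rwa [h]⟩⟩
  rw [Nat.one_le_iff_ne_zero, Ne, List.length_eq_zero_iff]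
  rintro rfl
  exact wordList_ne_nil w hf.symm

theorem IsMinRFact.tupleSim {u v : FreeSemigroup (IdemE S)} {m n : ℕ}
    {p q : ℕ → FreeSemigroup (IdemE S)} (hp : IsMinRFact u m p) (hq : IsMinRFact v n q)
    (h : igBar u = igBar v) : m = n ∧ TupleSim m p q := by
  obtain ⟨hm, hp, hpu⟩ := isMinRFact_iff.1 hp
  obtain ⟨hn, hq, hqv⟩ := isMinRFact_iff.1 hq
  have hs := hp.factSim_of_wordVal_eq hq (by rw [hpu, hqv, ← igBar_eq_iff, h])
  obtain rfl : m = n := by simpa using hs.length_eq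
  refine ⟨rfl, ?_⟩
  have hs' := hs.tupleSim u (by rw [← List.length_pos_iff, length_factList]; exact hm)
  rw [length_factList] at hs'
  exact .head (tupleApprox_of_agree hm fun j h₁ h₂ => (tupleOfList_factList u p h₁ h₂).symm)
    (hs'.tail (tupleApprox_of_agree hm fun j h₁ h₂ => tupleOfList_factList u q h₁ h₂))

theorem igBar_eq_of_tupleSim {u v : FreeSemigroup (IdemE S)} {m : ℕ}
    {p q : ℕ → FreeSemigroup (IdemE S)} (hp : IsMinRFact u m p) (hq : IsMinRFact v m q)
    (h : TupleSim m p q) : igBar u = igBar v := by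
  rw [igBar_eq_iff, ← (isMinRFact_iff.1 hp).2.2, ← (isMinRFact_iff.1 hq).2.2, ← prod_factVals,
    ← prod_factVals, h.prod_eq]

end Tuples

theorem stmt5 {S : Type*} [Semigroup S] [Finite (IdemE S)]
    (u v : FreeSemigroup (IdemE S)) :
    (igBar u = igBar v ↔
      ∃ (m : ℕ) (p q : ℕ → FreeSemigroup (IdemE S)),
        IsMinRFact u m p ∧ IsMinRFact v m q ∧ TupleSim m p q) ∧
    (igBar u = igBar v ↔
      ∃ m : ℕ, 1 ≤ m ∧
        (∀ (k : ℕ) (p : ℕ → FreeSemigroup (IdemE S)), IsMinRFact u k p → k = m) ∧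
        (∀ (k : ℕ) (q : ℕ → FreeSemigroup (IdemE S)), IsMinRFact v k q → k = m) ∧
        ∀ p q : ℕ → FreeSemigroup (IdemE S),
          IsMinRFact u m p → IsMinRFact v m q → TupleSim m p q) := by
  obtain ⟨m, p, hp⟩ := exists_isMinRFact u
  obtain ⟨n, q, hq⟩ := exists_isMinRFact v
  refine ⟨⟨fun h => ?_, ?_⟩, fun h => ?_, ?_⟩
  · obtain ⟨rfl, hs⟩ := hp.tupleSim hq h
    exact ⟨m, p, q, hp, hq, hs⟩
  · rintro ⟨k, p, q, hp, hq, hs⟩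
    exact igBar_eq_of_tupleSim hp hq hs
  · exact ⟨m, hp.1.1, fun k p' hp' => (hp'.tupleSim hp rfl).1,
      fun k q' hq' => (hq'.tupleSim hp h.symm).1, fun p' q' hp' hq' => (hp'.tupleSim hq' h).2⟩
  · rintro ⟨k, -, hu, hv, hs⟩
    obtain rfl := hu m p hp
    obtain rfl := hv n q hq
    exact igBar_eq_of_tupleSim hp hq (hs p q hp hq)
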